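/- arXiv:1310.2122 — 2 statements merged into one kernel-verified Lean document; each statement's English description precedes it below -/
import Mathlib

section
/- For every real number d and every integer n ≥ 1, one has the closed formula π_n^{(d)} = Σ_{k=1}^{n} t_{n−1, n−k} · d^k, where t_{m,j} = binom(m+j, j) − binom(m+j, j−1) is the Catalan triangle (with the convention binom(m, −1) = 0); explicitly, π_n^{(d)} = Σ_{k=1}^{n} ( binom(2n−1−k, n−k) − binom(2n−1−k, n−k−1) ) · d^k. -/
/-- The height of a lattice path (encoded by its steps: `true` = up-step `(1,1)`,
`false` = down-step `(1,-1)`) after `k` steps. -/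
def pathHeight {m : ℕ} (w : Fin m → Bool) (k : ℕ) : ℤ :=
  ∑ i ∈ Finset.univ.filter (fun i : Fin m => (i : ℕ) < k), (if w i then (1 : ℤ) else -1)

/-- `w` encodes a Dyck path: it ends at height `0` and never goes below the `x`-axis. -/
def IsDyckPath {m : ℕ} (w : Fin m → Bool) : Prop :=
  pathHeight w m = 0 ∧ ∀ k, 0 ≤ pathHeight w k

open Classical in
/-- The set of Dyck paths of order `n` (having `2n` steps). -/
noncomputable def dyckPaths (n : ℕ) : Finset (Fin (2 * n) → Bool) :=
  Finset.univ.filter fun w => IsDyckPath w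

/-- The number of meetings of the path `w` with the `x`-axis, excluding the final point. -/
def xi {m : ℕ} (w : Fin m → Bool) : ℕ :=
  ((Finset.range m).filter fun k => pathHeight w k = 0).card

/-- The numbers `π_n^{(d)} = Σ_{w ∈ D_n} d^{ξ(w)}` (with `π_0^{(d)} = 1`). -/
noncomputable def piD (d : ℝ) (n : ℕ) : ℝ :=
  ∑ w ∈ dyckPaths n, d ^ xi w

/-- The Catalan triangle `t_{m,j} = binom(m+j, j) − binom(m+j, j−1)`,
with the convention `binom(m, −1) = 0`. -/
def catalanTriangle (m j : ℕ) : ℤ :=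
  (Nat.choose (m + j) j : ℤ) - if j = 0 then 0 else (Nat.choose (m + j) (j - 1) : ℤ)

lemma pathHeight_zero {m : ℕ} (w : Fin m → Bool) : pathHeight w 0 = 0 := by
  simp [pathHeight]

lemma pathHeight_cons {m : ℕ} (b : Bool) (w : Fin m → Bool) (k : ℕ) :
    pathHeight (Fin.cons b w : Fin (m + 1) → Bool) (k + 1) =
      (if b then 1 else -1) + pathHeight w k := by
  simp [pathHeight, Finset.sum_filter, Fin.sum_univ_succ]

open Classical in
/-- The weight `d ^ r` of the path `w` started at height `h`, where `r` counts its meetings with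
the `x`-axis before the endpoint; it is `0` unless the path stays nonnegative and ends at `0`. -/
noncomputable def shiftedWeight (d : ℝ) {m : ℕ} (w : Fin m → Bool) (h : ℤ) : ℝ :=
  if h + pathHeight w m = 0 ∧ ∀ k, 0 ≤ h + pathHeight w k then
    d ^ ((Finset.range m).filter fun k => h + pathHeight w k = 0).card
  else 0

lemma shiftedWeight_of_neg (d : ℝ) {m : ℕ} (w : Fin m → Bool) {h : ℤ} (hh : h < 0) :
    shiftedWeight d w h = 0 := by
  refine if_neg fun H => ?_
  have := H.2 0
  rw [pathHeight_zero] at this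
  omega

lemma shiftedWeight_cons (d : ℝ) {m : ℕ} (b : Bool) (w : Fin m → Bool) {h : ℤ} (hh : 0 ≤ h) :
    shiftedWeight d (Fin.cons b w : Fin (m + 1) → Bool) h =
      (if h = 0 then d else 1) * shiftedWeight d w (h + if b then 1 else -1) := by
  have hcond : (h + pathHeight (Fin.cons b w : Fin (m + 1) → Bool) (m + 1) = 0 ∧
      ∀ k, 0 ≤ h + pathHeight (Fin.cons b w : Fin (m + 1) → Bool) k) ↔
      ((h + if b then 1 else -1) + pathHeight w m = 0 ∧
        ∀ k, 0 ≤ (h + if b then 1 else -1) + pathHeight w k) := by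
    rw [pathHeight_cons, add_assoc]
    refine and_congr_right fun _ => ⟨fun H k => ?_, fun H k => ?_⟩
    · have := H (k + 1)
      rwa [pathHeight_cons, ← add_assoc] at this
    · cases k with
      | zero => simpa [pathHeight_zero] using hh
      | succ k => rw [pathHeight_cons, ← add_assoc]; exact H k
  have hcard : ((Finset.range (m + 1)).filter fun k =>
        h + pathHeight (Fin.cons b w : Fin (m + 1) → Bool) k = 0).card =
      ((Finset.range m).filter fun k =>
        (h + if b then 1 else -1) + pathHeight w k = 0).card + if h = 0 then 1 else 0 := by
    simp only [Finset.card_filter, Finset.sum_range_succ', pathHeight_cons, pathHeight_zero,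
      add_zero, add_assoc]
  unfold shiftedWeight
  by_cases H : (h + if b then 1 else -1) + pathHeight w m = 0 ∧
      ∀ k, 0 ≤ (h + if b then 1 else -1) + pathHeight w k
  · rw [if_pos (hcond.2 H), if_pos H, hcard, pow_add, mul_comm]
    split_ifs <;> simp
  · rw [if_neg (mt hcond.1 H), if_neg H, mul_zero]

lemma sum_shiftedWeight_succ (d : ℝ) (m : ℕ) {h : ℤ} (hh : 0 ≤ h) :
    ∑ w : Fin (m + 1) → Bool, shiftedWeight d w h =
      (if h = 0 then d else 1) *
        (∑ w : Fin m → Bool, shiftedWeight d w (h + 1) +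
          ∑ w : Fin m → Bool, shiftedWeight d w (h - 1)) := by
  rw [← (Fin.consEquiv fun _ : Fin (m + 1) => Bool).sum_comp, Fintype.sum_prod_type]
  simp only [Fin.consEquiv, Equiv.coe_fn_mk, shiftedWeight_cons d _ _ hh, ← Finset.mul_sum]
  simp [sub_eq_add_neg]

/-- The number of paths with `m` steps from height `r` that reach height `0` for the first time
at their endpoint. -/
def firstPassageCount : ℕ → ℕ → ℤ
  | 0, 0 => 1
  | 0, _ + 1 => 0
  | _ + 1, 0 => 0
  | m + 1, r + 1 => firstPassageCount m r + firstPassageCount m (r + 2)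

lemma firstPassageCount_of_lt {m r : ℕ} (h : m < r) : firstPassageCount m r = 0 := by
  induction m generalizing r with
  | zero => obtain _ | r := r <;> simp_all [firstPassageCount]
  | succ m ih =>
    obtain _ | r := r
    · rfl
    · rw [firstPassageCount, ih (by omega), ih (by omega), add_zero]

lemma sum_shiftedWeight (d : ℝ) (m h : ℕ) :
    ∑ w : Fin m → Bool, shiftedWeight d w h =
      ∑ j ∈ Finset.range (m + 1), (firstPassageCount (m - j) (h + j) : ℝ) * d ^ j := by
  induction m generalizing h with
  | zero =>
    obtain _ | h := h
    · simp [shiftedWeight, pathHeight, firstPassageCount]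
    · have : (h : ℤ) + 1 ≠ 0 := by omega
      simp [shiftedWeight, pathHeight, firstPassageCount, this]
  | succ m ih =>
    rw [sum_shiftedWeight_succ d m (Int.natCast_nonneg h)]
    obtain _ | h := h
    · have h1 := ih 1
      rw [Finset.sum_range_succ']
      simp only [Nat.cast_one] at h1
      simp only [Nat.cast_zero, zero_add, zero_sub, if_true, h1,
        shiftedWeight_of_neg d _ (show (-1 : ℤ) < 0 by norm_num)]
      simp only [Finset.sum_const_zero, add_zero, Finset.mul_sum, firstPassageCount, tsub_zero,
        Int.cast_zero, zero_mul]
      refine Finset.sum_congr rfl fun j _ => ?_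
      rw [Nat.add_sub_add_right, add_comm 1 j]
      ring
    · have h0 : ((h + 1 : ℕ) : ℤ) ≠ 0 := by omega
      have h1 : ((h + 1 : ℕ) : ℤ) + 1 = (h + 2 : ℕ) := by push_cast; ring
      have h2 : ((h + 1 : ℕ) : ℤ) - 1 = (h : ℕ) := by push_cast; ring
      rw [if_neg h0, h1, h2, ih, ih, one_mul, ← Finset.sum_add_distrib,
        Finset.sum_range_succ _ (m + 1),
        firstPassageCount_of_lt (show m + 1 - (m + 1) < h + 1 + (m + 1) by omega)]
      simp only [Int.cast_zero, zero_mul, add_zero]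
      refine Finset.sum_congr rfl fun j hj => ?_
      have hj' : m + 1 - j = m - j + 1 := by have := Finset.mem_range.1 hj; omega
      rw [hj', show h + 1 + j = h + j + 1 by ring, firstPassageCount,
        show h + 2 + j = h + j + 2 by ring]
      push_cast
      ring

lemma catalanTriangle_succ_succ (m j : ℕ) :
    catalanTriangle (m + 1) (j + 1) = catalanTriangle m (j + 1) + catalanTriangle (m + 1) j := by
  unfold catalanTriangle
  obtain _ | j := j
  · simp [Nat.choose_one_right]
  · rw [show m + 1 + (j + 1 + 1) = m + j + 2 + 1 by ring,
      show m + (j + 1 + 1) = m + j + 2 by ring, show m + 1 + (j + 1) = m + j + 2 by ring]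
    simp only [Nat.add_sub_cancel, Nat.choose_succ_succ (m + j + 2)]
    simp
    ring

lemma catalanTriangle_self_succ (m : ℕ) : catalanTriangle m (m + 1) = 0 := by
  have := Nat.choose_symm_of_eq_add (show m + (m + 1) = m + (m + 1) from rfl)
  simp [catalanTriangle, this]

lemma firstPassageCount_eq_catalanTriangle (r s : ℕ) :
    firstPassageCount (r + 2 * s + 1) (r + 1) = catalanTriangle (r + s) s := by
  induction s generalizing r with
  | zero =>
    induction r with
    | zero => simp [firstPassageCount, catalanTriangle]
    | succ r ih =>
      rw [firstPassageCount, firstPassageCount_of_lt (r := r + 1 + 2) (by omega)]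
      simpa [catalanTriangle] using ih
  | succ s ihs =>
    have key (r : ℕ) : firstPassageCount (r + 2 * (s + 1)) (r + 2) =
        catalanTriangle (r + s + 1) s := by
      rw [show r + s + 1 = r + 1 + s by ring, ← ihs]
      congr 1; ring
    induction r with
    | zero =>
      rw [firstPassageCount, key, show 0 + 2 * (s + 1) = 2 * s + 1 + 1 by ring,
        firstPassageCount, ← add_assoc, zero_add,
        zero_add, catalanTriangle_succ_succ, catalanTriangle_self_succ, zero_add]
    | succ r ihr =>
      rw [firstPassageCount, key, show r + 1 + 2 * (s + 1) = r + 2 * (s + 1) + 1 by ring, ihr,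
        show r + 1 + (s + 1) = r + s + 1 + 1 by ring, catalanTriangle_succ_succ,
        show r + 1 + s + 1 = r + s + 1 + 1 by ring, add_assoc r s 1]

lemma piD_eq_sum_shiftedWeight (d : ℝ) (n : ℕ) :
    piD d n = ∑ w : Fin (2 * n) → Bool, shiftedWeight d w (0 : ℕ) := by
  rw [piD, dyckPaths, Finset.sum_filter]
  refine Finset.sum_congr rfl fun w _ => ?_
  unfold shiftedWeight
  by_cases H : IsDyckPath w
  · rw [if_pos H, if_pos (by simpa [IsDyckPath] using H)]
    simp [xi]
  · rw [if_neg H, if_neg (by simpa [IsDyckPath] using H)]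

theorem stmt_4 (d : ℝ) (n : ℕ) (hn : 1 ≤ n) :
    piD d n = ∑ k ∈ Finset.Icc 1 n, (catalanTriangle (n - 1) (n - k) : ℝ) * d ^ k := by
  rw [piD_eq_sum_shiftedWeight, sum_shiftedWeight]
  symm
  refine Finset.sum_subset_zero_on_sdiff (fun k hk => ?_) (fun k hk => ?_) (fun k hk => ?_)
  · simp only [Finset.mem_Icc, Finset.mem_range] at *
    omega
  · simp only [Finset.mem_sdiff, Finset.mem_Icc, Finset.mem_range] at hk
    obtain _ | k := k
    · obtain ⟨n, rfl⟩ := Nat.exists_eq_add_of_le' hn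
      rw [show 2 * (n + 1) - 0 = 2 * n + 1 + 1 by omega, firstPassageCount]
      simp
    · rw [firstPassageCount_of_lt (by omega)]
      simp
  · obtain ⟨h1, h2⟩ := Finset.mem_Icc.1 hk
    obtain ⟨r, rfl⟩ := Nat.exists_eq_add_of_le' h1
    obtain ⟨s, rfl⟩ := Nat.exists_eq_add_of_le h2
    rw [show r + 1 + s - 1 = r + s by omega, show r + 1 + s - (r + 1) = s by omega,
      show 2 * (r + 1 + s) - (r + 1) = r + 2 * s + 1 by omega, zero_add,
      firstPassageCount_eq_catalanTriangle]
end

section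
/- For every real number d < 0, the purely imaginary complex number z = (d/√(1−d))·i satisfies z/d + ∫_ℝ (t − z)^{−1} dσ(t) = 0, and likewise its conjugate −(d/√(1−d))·i; that is, z_{(d)}^± = ±(d/√(1−d))·i are zeros of the limiting Weyl function Q_{(d)}(z) = z/d + ∫_ℝ (t − z)^{−1} dσ(t). -/
open MeasureTheory

/-- The semicircle distribution: the probability measure on `ℝ` with density
`t ↦ (1/(2π))√(4−t²)` on `[−2,2]` and `0` elsewhere (recall `Real.sqrt` of a negative
number is `0`). -/
noncomputable def semicircle : Measure ℝ :=
  MeasureTheory.volume.withDensity fun t => ENNReal.ofReal ((2 * Real.pi)⁻¹ * Real.sqrt (4 - t ^ 2))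

/-- An antiderivative of `√(4 - t²) / (t² + a²)` on `(-2, 2)`. -/
lemma hasDerivAt_arcsin_sub_arcsin {a t : ℝ} (ha : 0 < a) (ht : t ∈ Set.Ioo (-2 : ℝ) 2) :
    HasDerivAt (fun t : ℝ => √(4 + a ^ 2) / a * Real.arcsin (√(4 + a ^ 2) * t / (2 * √(t ^ 2 + a ^ 2)))
      - Real.arcsin (t / 2)) (√(4 - t ^ 2) / (t ^ 2 + a ^ 2)) t := by
  obtain ⟨h1, h2⟩ := ht
  have h4 : 0 < 4 - t ^ 2 := by nlinarith
  have hq : 0 < t ^ 2 + a ^ 2 := by positivity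
  have hc : √(4 + a ^ 2) ^ 2 = 4 + a ^ 2 := Real.sq_sqrt (by positivity)
  have hr : √(t ^ 2 + a ^ 2) ^ 2 = t ^ 2 + a ^ 2 := Real.sq_sqrt hq.le
  have hs : √(4 - t ^ 2) ^ 2 = 4 - t ^ 2 := Real.sq_sqrt h4.le
  have hr0 : 0 < √(t ^ 2 + a ^ 2) := Real.sqrt_pos.2 hq
  have hs0 : 0 < √(4 - t ^ 2) := Real.sqrt_pos.2 h4
  have hdr : HasDerivAt (fun t : ℝ => √(t ^ 2 + a ^ 2)) (t / √(t ^ 2 + a ^ 2)) t := by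
    refine (((hasDerivAt_pow 2 t).add_const (a ^ 2)).sqrt hq.ne').congr_deriv ?_
    norm_num
    field_simp
  generalize hc' : √(4 + a ^ 2) = c at *
  have hu : HasDerivAt (fun t : ℝ => c * t / (2 * √(t ^ 2 + a ^ 2)))
      (c * a ^ 2 / (2 * √(t ^ 2 + a ^ 2) ^ 3)) t := by
    refine (((hasDerivAt_id' t).const_mul c).div (hdr.const_mul 2) (by positivity)).congr_deriv ?_
    generalize √(t ^ 2 + a ^ 2) = r at *
    field_simp
    linear_combination c * hr
  generalize hr' : √(t ^ 2 + a ^ 2) = r at *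
  generalize hs' : √(4 - t ^ 2) = s at *
  have hone : 1 - (c * t / (2 * r)) ^ 2 = (a * s / (2 * r)) ^ 2 := by
    field_simp
    linear_combination 4 * hr - t ^ 2 * hc - a ^ 2 * hs
  have hsqrt : √(1 - (c * t / (2 * r)) ^ 2) = a * s / (2 * r) := by
    rw [hone, Real.sqrt_sq (by positivity)]
  have hpos : 0 < 1 - (c * t / (2 * r)) ^ 2 := by rw [hone]; positivity
  have hsqrt2 : √(1 - (t / 2) ^ 2) = s / 2 := by
    rw [show 1 - (t / 2) ^ 2 = (s / 2) ^ 2 by linear_combination -hs / 4,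
      Real.sqrt_sq (by positivity)]
  have hA := (Real.hasDerivAt_arcsin (x := c * t / (2 * r))
    (by intro h; rw [h] at hpos; norm_num at hpos)
    (by intro h; rw [h] at hpos; norm_num at hpos))
  have hB := (Real.hasDerivAt_arcsin (x := t / 2) (by linarith) (by linarith)).comp t
    ((hasDerivAt_id' t).div_const 2)
  rw [hsqrt] at hA
  rw [hsqrt2] at hB
  rw [← hr'] at hA
  have hA' := hA.comp t hu
  rw [hr'] at hA'
  refine ((hA'.const_mul (c / a)).sub hB).congr_deriv ?_
  rw [← hr]
  field_simp
  linear_combination hc - hr - hs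

lemma integral_sqrt_four_sub_sq_div {a : ℝ} (ha : 0 < a) :
    ∫ t in (-2 : ℝ)..2, √(4 - t ^ 2) / (t ^ 2 + a ^ 2) = Real.pi * (√(4 + a ^ 2) / a - 1) := by
  have hq : ∀ t : ℝ, t ^ 2 + a ^ 2 ≠ 0 := fun t => by positivity
  have hq' : ∀ t : ℝ, 2 * √(t ^ 2 + a ^ 2) ≠ 0 := fun t => by positivity
  have hc : √(4 + a ^ 2) ≠ 0 := by positivity
  rw [intervalIntegral.integral_eq_sub_of_hasDerivAt_of_le (by norm_num)
    (Continuous.continuousOn ?_) (fun t ht => hasDerivAt_arcsin_sub_arcsin ha ht)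
    (Continuous.intervalIntegrable ?_ _ _)]
  · have h1 : √(4 + a ^ 2) * 2 / (2 * √(2 ^ 2 + a ^ 2)) = 1 := by
      norm_num
      field_simp
    have h2 : √(4 + a ^ 2) * (-2) / (2 * √((-2) ^ 2 + a ^ 2)) = -1 := by
      norm_num
      field_simp
    rw [h1, h2]
    norm_num
    ring
  · exact (continuous_const.mul (Real.continuous_arcsin.comp
      ((by fun_prop : Continuous fun t : ℝ => √(4 + a ^ 2) * t).div (by fun_prop) hq'))).sub
      (Real.continuous_arcsin.comp (by fun_prop))
  · exact (by fun_prop : Continuous fun t : ℝ => √(4 - t ^ 2)).div (by fun_prop) hq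

lemma sqrt_four_sub_sq_eq_zero {t : ℝ} (ht : t ∉ Set.Ioc (-2 : ℝ) 2) : √(4 - t ^ 2) = 0 := by
  apply Real.sqrt_eq_zero_of_nonpos
  by_contra! h
  exact ht ⟨by nlinarith, by nlinarith⟩

lemma integral_semicircle (f : ℝ → ℂ) :
    ∫ t, f t ∂semicircle = ∫ t, (((2 * Real.pi)⁻¹ * √(4 - t ^ 2) : ℝ) : ℂ) * f t := by
  rw [semicircle, integral_withDensity_eq_integral_toReal_smul (by fun_prop) (by simp)]
  congr 1 with t
  rw [ENNReal.toReal_ofReal (by positivity), Complex.real_smul]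

/-- The Stieltjes transform of the semicircle distribution on the imaginary axis. -/
lemma integral_semicircle_inv_sub_mul_I {y : ℝ} (hy : y ≠ 0) :
    ∫ t, ((t : ℂ) - y * Complex.I)⁻¹ ∂semicircle =
      ((y / 2 * (√(4 + y ^ 2) / |y| - 1) : ℝ) : ℂ) * Complex.I := by
  rw [integral_semicircle]
  set h : ℝ → ℂ := fun t =>
    (((2 * Real.pi)⁻¹ * √(4 - t ^ 2) : ℝ) : ℂ) * ((t : ℂ) - y * Complex.I)⁻¹ with hh
  have hne : ∀ t : ℝ, (t : ℂ) - y * Complex.I ≠ 0 := fun t ht => hy (by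
    simpa using congrArg Complex.im ht)
  have hcont : Continuous h := by
    refine Continuous.mul (by fun_prop) (Continuous.inv₀ (by fun_prop) hne)
  have hint : Integrable h := by
    refine hcont.integrable_of_hasCompactSupport
      (HasCompactSupport.intro (isCompact_Icc (a := (-2 : ℝ)) (b := 2)) fun t ht => ?_)
    simp [hh, sqrt_four_sub_sq_eq_zero fun h' => ht (Set.Ioc_subset_Icc_self h')]
  have hsum : ∀ t, h t + h (-t) =
      ((y / Real.pi * (√(4 - t ^ 2) / (t ^ 2 + |y| ^ 2)) : ℝ) : ℂ) * Complex.I := fun t => by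
    have h1 := hne t
    have h2 := hne (-t)
    have h3 : ((t : ℂ) ^ 2 + y ^ 2) ≠ 0 := by
      have : t ^ 2 + y ^ 2 ≠ 0 := by positivity
      exact_mod_cast this
    have hpi : (Real.pi : ℂ) ≠ 0 := by exact_mod_cast Real.pi_ne_zero
    have hinv : ((t : ℂ) - y * Complex.I)⁻¹ + (((-t : ℝ) : ℂ) - y * Complex.I)⁻¹ =
        2 * y * Complex.I / (t ^ 2 + y ^ 2) := by
      rw [inv_add_inv h1 h2, div_eq_div_iff (mul_ne_zero h1 h2) h3]
      push_cast
      linear_combination (-2 * y ^ 3 * Complex.I) * Complex.I_sq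
    simp only [hh, neg_sq, sq_abs]
    rw [← mul_add, hinv]
    push_cast
    field_simp
  have hdouble : 2 * ∫ t, h t = ∫ t, (h t + h (-t)) := by
    rw [integral_add hint hint.comp_neg, integral_neg_eq_self h volume, two_mul]
  have hreal : ∫ t : ℝ, √(4 - t ^ 2) / (t ^ 2 + |y| ^ 2) =
      Real.pi * (√(4 + y ^ 2) / |y| - 1) := by
    rw [← setIntegral_eq_integral_of_forall_compl_eq_zero (s := Set.Ioc (-2 : ℝ) 2)
      fun t ht => by rw [sqrt_four_sub_sq_eq_zero ht, zero_div],
      ← intervalIntegral.integral_of_le (by norm_num),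
      integral_sqrt_four_sub_sq_div (abs_pos.2 hy), sq_abs]
  simp_rw [hsum] at hdouble
  rw [integral_mul_const, integral_complex_ofReal, integral_const_mul, hreal] at hdouble
  have hpi := Real.pi_ne_zero
  rw [show y / Real.pi * (Real.pi * (√(4 + y ^ 2) / |y| - 1)) =
    2 * (y / 2 * (√(4 + y ^ 2) / |y| - 1)) by field_simp] at hdouble
  refine mul_left_cancel₀ (two_ne_zero (α := ℂ)) (hdouble.trans ?_)
  push_cast
  ring

/-- For `d < 0`, the purely imaginary numbers `z_{(d)}^± = ±(d/√(1−d))·i` are zeros of the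
limiting Weyl function `Q_{(d)}(z) = z/d + ∫ (t − z)⁻¹ dσ(t)`. -/
theorem stmt_15 (d : ℝ) (hd : d < 0) :
    ((d / Real.sqrt (1 - d) : ℝ) : ℂ) * Complex.I / (d : ℂ) +
        (∫ t, ((t : ℂ) - ((d / Real.sqrt (1 - d) : ℝ) : ℂ) * Complex.I)⁻¹ ∂semicircle) = 0 ∧
    -(((d / Real.sqrt (1 - d) : ℝ) : ℂ) * Complex.I) / (d : ℂ) +
        (∫ t, ((t : ℂ) - (-(((d / Real.sqrt (1 - d) : ℝ) : ℂ) * Complex.I)))⁻¹ ∂semicircle) = 0 := by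
  have hs : 0 < √(1 - d) := Real.sqrt_pos.2 (by linarith)
  have hs2 : √(1 - d) ^ 2 = 1 - d := Real.sq_sqrt (by linarith)
  have hd0 : (d : ℂ) ≠ 0 := by exact_mod_cast hd.ne
  generalize √(1 - d) = s at *
  have hy : d / s < 0 := div_neg_of_neg_of_pos hd hs
  have hsqrt : √(4 + (d / s) ^ 2) = (2 - d) / s := by
    rw [show 4 + (d / s) ^ 2 = ((2 - d) / s) ^ 2 by
      field_simp
      linear_combination 4 * hs2, Real.sqrt_sq (div_nonneg (by linarith) hs.le)]
  have hval : d / s / 2 * ((2 - d) / s / -(d / s) - 1) = -(1 / s) := by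
    have := hd.ne
    field_simp
    ring
  have hdiv : ((d / s : ℝ) : ℂ) * Complex.I / d = ((1 / s : ℝ) : ℂ) * Complex.I := by
    push_cast
    field_simp
  constructor
  · rw [integral_semicircle_inv_sub_mul_I hy.ne, hsqrt, abs_of_neg hy, hval, hdiv]
    push_cast
    ring
  · rw [← neg_mul, ← Complex.ofReal_neg, integral_semicircle_inv_sub_mul_I (neg_ne_zero.2 hy.ne),
      neg_sq, abs_neg, hsqrt, abs_of_neg hy, neg_div, neg_mul, hval, Complex.ofReal_neg,
      neg_mul, neg_div, hdiv]
    push_cast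
    ring
end
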